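/- For every a > 0 and every x > 0, the quantity h(x) admits the double-integral representation h(x) = ∫_{−x}^{ax} ∫_{−x}^{ax} φ(u)·φ(v)·Γ(u,v) du dv, where Γ(u,v) = 2(u+v)(u−v)². -/

import Mathlib

open MeasureTheory intervalIntegral

/-- `φ(x) = exp(-x²)`. -/
noncomputable def phi (x : ℝ) : ℝ := Real.exp (-x ^ 2)

/-- `Φ(x) = ∫₀ˣ φ(u) du`. -/
noncomputable def Phi (x : ℝ) : ℝ := ∫ u in (0 : ℝ)..x, phi u

/-- `φ'(x) = -2x·exp(-x²)`, the derivative of `φ`. -/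
noncomputable def phi' (x : ℝ) : ℝ := -2 * x * Real.exp (-x ^ 2)

/-- `f(x) = (φ(ax) - φ(x)) / (x·(Φ(ax) + Φ(x)))`. -/
noncomputable def f (a x : ℝ) : ℝ :=
  (phi (a * x) - phi x) / (x * (Phi (a * x) + Phi x))

/-- `h(x) = (axφ'(ax) - xφ'(x))(Φ(ax)+Φ(x)) - (φ(ax)-φ(x))(Φ(ax)+Φ(x))
      - (φ(ax)-φ(x))(axφ(ax)+xφ(x))`. -/
noncomputable def h (a x : ℝ) : ℝ :=
  (a * x * phi' (a * x) - x * phi' x) * (Phi (a * x) + Phi x)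
    - (phi (a * x) - phi x) * (Phi (a * x) + Phi x)
    - (phi (a * x) - phi x) * (a * x * phi (a * x) + x * phi x)

lemma continuous_phi : Continuous phi := by
  unfold phi
  fun_prop

lemma hasDerivAt_phi (u : ℝ) : HasDerivAt phi (-2 * u * phi u) u := by
  have h₁ : HasDerivAt phi _ u := (hasDerivAt_pow 2 u).neg.exp
  refine h₁.congr_deriv ?_
  simp [phi]
  ring

lemma phi_neg (u : ℝ) : phi (-u) = phi u := by
  simp [phi]

lemma Phi_neg (x : ℝ) : Phi (-x) = -Phi x := by
  have h₁ := intervalIntegral.integral_comp_neg (a := 0) (b := x) phi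
  simp only [phi_neg, neg_zero] at h₁
  rw [Phi, Phi, h₁, intervalIntegral.integral_symm]

lemma intervalIntegrable_pow_mul_phi (n : ℕ) (c d : ℝ) :
    IntervalIntegrable (fun u => u ^ n * phi u) volume c d :=
  ((continuous_pow n).mul continuous_phi).intervalIntegrable c d

lemma integral_phi (c d : ℝ) : ∫ u in c..d, phi u = Phi d - Phi c :=
  (intervalIntegral.integral_interval_sub_left
    (continuous_phi.intervalIntegrable _ _) (continuous_phi.intervalIntegrable _ _)).symm

lemma integral_id_mul_phi (c d : ℝ) :
    ∫ u in c..d, u ^ 1 * phi u = -(phi d - phi c) / 2 := by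
  have h₁ := intervalIntegral.integral_eq_sub_of_hasDerivAt (a := c) (b := d)
    (f := fun u => -phi u / 2) (f' := fun u => u ^ 1 * phi u)
    (fun u _ => ((hasDerivAt_phi u).neg.div_const 2).congr_deriv (by ring))
    (intervalIntegrable_pow_mul_phi 1 c d)
  rw [h₁]
  ring

/-- Integration by parts for the moments of `φ`. -/
lemma integral_pow_add_two_mul_phi (n : ℕ) (c d : ℝ) :
    ∫ u in c..d, u ^ (n + 2) * phi u =
      ((n + 1) * (∫ u in c..d, u ^ n * phi u)
        - (d ^ (n + 1) * phi d - c ^ (n + 1) * phi c)) / 2 := by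
  have h₁ := intervalIntegral.integral_eq_sub_of_hasDerivAt (a := c) (b := d)
    (f := fun u => u ^ (n + 1) * phi u)
    (f' := fun u => (n + 1) * (u ^ n * phi u) - 2 * (u ^ (n + 2) * phi u))
    (fun u _ => ((hasDerivAt_pow (n + 1) u).mul (hasDerivAt_phi u)).congr_deriv (by
      push_cast [Nat.add_sub_cancel]
      ring))
    (((intervalIntegrable_pow_mul_phi n c d).const_mul _).sub
      ((intervalIntegrable_pow_mul_phi (n + 2) c d).const_mul _))
  rw [intervalIntegral.integral_sub
    ((intervalIntegrable_pow_mul_phi n c d).const_mul _)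
    ((intervalIntegrable_pow_mul_phi (n + 2) c d).const_mul _),
    intervalIntegral.integral_const_mul, intervalIntegral.integral_const_mul] at h₁
  linarith

lemma integral_cubic_mul_phi (p q r s c d : ℝ) :
    ∫ u in c..d, (p * (u ^ 0 * phi u) + q * (u ^ 1 * phi u) + r * (u ^ 2 * phi u)
        + s * (u ^ 3 * phi u)) =
      p * (∫ u in c..d, u ^ 0 * phi u) + q * (∫ u in c..d, u ^ 1 * phi u)
        + r * (∫ u in c..d, u ^ 2 * phi u) + s * (∫ u in c..d, u ^ 3 * phi u) := by
  have hi (t : ℝ) (n : ℕ) := (intervalIntegrable_pow_mul_phi n c d).const_mul t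
  rw [intervalIntegral.integral_add (((hi p 0).add (hi q 1)).add (hi r 2)) (hi s 3),
    intervalIntegral.integral_add ((hi p 0).add (hi q 1)) (hi r 2),
    intervalIntegral.integral_add (hi p 0) (hi q 1)]
  simp only [intervalIntegral.integral_const_mul]

lemma integral_integral_kernel (c d : ℝ) :
    ∫ v in c..d, ∫ u in c..d, phi u * phi v * (2 * (u + v) * (u - v) ^ 2) =
      4 * ((∫ u in c..d, u ^ 3 * phi u) * (∫ u in c..d, u ^ 0 * phi u)
        - (∫ u in c..d, u ^ 2 * phi u) * (∫ u in c..d, u ^ 1 * phi u)) := by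
  have inner (v : ℝ) :
      ∫ u in c..d, phi u * phi v * (2 * (u + v) * (u - v) ^ 2) =
        2 * (∫ u in c..d, u ^ 3 * phi u) * (v ^ 0 * phi v)
          + -2 * (∫ u in c..d, u ^ 2 * phi u) * (v ^ 1 * phi v)
          + -2 * (∫ u in c..d, u ^ 1 * phi u) * (v ^ 2 * phi v)
          + 2 * (∫ u in c..d, u ^ 0 * phi u) * (v ^ 3 * phi v) := by
    have h₁ := integral_cubic_mul_phi (2 * v ^ 3 * phi v) (-2 * v ^ 2 * phi v)
      (-2 * v * phi v) (2 * phi v) c d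
    rw [← sub_eq_zero] at h₁ ⊢
    rw [← h₁]
    congr 1
    · congr 1
      funext u
      ring
    · ring
  simp only [inner]
  rw [integral_cubic_mul_phi]
  ring

theorem statement_9 (a x : ℝ) (ha : 0 < a) (hx : 0 < x) :
    h a x =
      ∫ v in (-x)..(a * x), ∫ u in (-x)..(a * x),
        phi u * phi v * (2 * (u + v) * (u - v) ^ 2) := by
  rw [integral_integral_kernel, integral_pow_add_two_mul_phi 1,
    integral_pow_add_two_mul_phi 0, integral_id_mul_phi]
  simp only [pow_zero, one_mul, integral_phi, Phi_neg, phi_neg]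
  have hphi' (t : ℝ) : phi' t = -2 * t * phi t := rfl
  rw [h, hphi', hphi']
  push_cast
  ring
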